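/- (Binet formula for third-order Jacobsthal polynomials) Let x ∈ ℂ with x³ ≠ 1. Then for every integer n ≥ 0, J(n) = x^(n+1)/(x² + x + 1) - ω1^(n+1)/((x - ω1)·(ω1 - ω2)) + ω2^(n+1)/((x - ω2)·(ω1 - ω2)). -/

import Mathlib

noncomputable section

/-- The third-order Jacobsthal polynomial sequence (evaluated at `x : ℂ`). -/
def J (x : ℂ) : ℕ → ℂ
  | 0 => 0
  | 1 => 1
  | 2 => x - 1
  | n + 3 => (x - 1) * J x (n + 2) + (x - 1) * J x (n + 1) + x * J x n

theorem J_binet (x : ℂ) (hx : x ^ 3 ≠ 1)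
    (ω1 ω2 : ℂ) (hω1 : ω1 ^ 2 + ω1 + 1 = 0) (hω2 : ω2 ^ 2 + ω2 + 1 = 0)
    (hω : ω1 ≠ ω2) (n : ℕ) :
    J x n = x ^ (n + 1) / (x ^ 2 + x + 1)
      - ω1 ^ (n + 1) / ((x - ω1) * (ω1 - ω2))
      + ω2 ^ (n + 1) / ((x - ω2) * (ω1 - ω2)) := by
  have hsum : ω1 + ω2 = -1 := by
    apply mul_left_cancel₀ (sub_ne_zero.mpr hω)
    linear_combination hω1 - hω2
  have hfactor : x ^ 2 + x + 1 = (x - ω1) * (x - ω2) := by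
    linear_combination x * hsum - ω1 * hsum + hω1
  have hne : x ^ 2 + x + 1 ≠ 0 := fun h => hx (by linear_combination (x - 1) * h)
  rw [hfactor] at hne ⊢
  obtain ⟨h1, h2⟩ := mul_ne_zero_iff.mp hne
  have h12 : ω1 - ω2 ≠ 0 := sub_ne_zero.mpr hω
  induction n using Nat.strong_induction_on with
  | _ n ih =>
    match n with
    | 0 =>
      simp only [J]
      field_simp
      ring
    | 1 =>
      simp only [J]
      field_simp
      ring
    | 2 =>
      simp only [J]
      field_simp
      linear_combination (-(x - ω1) * (x - ω2) * (ω1 - ω2)) * hsum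
    | n + 3 =>
      rw [J, ih (n + 2) (by omega), ih (n + 1) (by omega), ih n (by omega)]
      linear_combination
        (ω1 - x) * ω1 ^ (n + 1) / ((x - ω1) * (ω1 - ω2)) * hω1
          - (ω2 - x) * ω2 ^ (n + 1) / ((x - ω2) * (ω1 - ω2)) * hω2
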